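/- arXiv:0912.1553 — 3 statements merged into one kernel-verified Lean document; each statement's English description precedes it below -/
import Mathlib

section
/- The Killing form of the 7-sphere structure functions is −6 times the identity: for all nonzero i, j ∈ G = (ℤ/2)³, Σ_{m,n ∈ G∖{0}} c_{min} · c_{njm} ≡ −6·δ_{ij} modulo the 7-sphere ideal I. -/
open MvPolynomial

/-- The group `G = (ℤ/2)³` of labels. -/
abbrev G3 : Type := Fin 3 → ZMod 2

/-- The octonion cochain `F(a,b) = (−1)^{∑_{i≤j} aᵢbⱼ + a₁a₂b₃ + a₁b₂a₃ + b₁a₂a₃}`,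
with components read as representatives in `{0,1}`. -/
def octF (a b : G3) : ℝ :=
  (-1) ^ ((a 0).val * (b 0).val + (a 0).val * (b 1).val + (a 0).val * (b 2).val
    + (a 1).val * (b 1).val + (a 1).val * (b 2).val + (a 2).val * (b 2).val
    + (a 0).val * (a 1).val * (b 2).val + (a 0).val * (b 1).val * (a 2).val
    + (b 0).val * (a 1).val * (a 2).val)

/-- The octonion associator `φ(a,b,c) = (−1)^{a·(b×c)}`, with the triple product
computed in `ℤ/2`. -/
def octPhi (a b c : G3) : ℝ :=
  (-1) ^ (a 0 * (b 1 * c 2 + b 2 * c 1) + a 1 * (b 2 * c 0 + b 0 * c 2)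
    + a 2 * (b 0 * c 1 + b 1 * c 0)).val

/-- The polynomial ring `R = ℝ[x_a : a ∈ G]` in eight variables indexed by `G`. -/
noncomputable abbrev R8 : Type := MvPolynomial G3 ℝ

/-- The structure functions `c_{ijk}` of the left-invariant coframe of `k(S⁷)`:
`c_{ijk} = −F(i,j)F(i+j,k) ∑_a φ(a,i,j) φ(a,i+j,k) F(a,i+j+k) x_a x_{a+i+j+k}`. -/
noncomputable def cS (i j k : G3) : R8 :=
  C (-(octF i j * octF (i + j) k)) *
    ∑ a : G3, C (octPhi a i j * octPhi a (i + j) k * octF a (i + j + k)) *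
      (X a * X (a + i + j + k))

/-- The 7-sphere ideal, generated by `∑_a x_a² − 1`. -/
noncomputable def sphere7 : Ideal R8 :=
  Ideal.span {(∑ a : G3, X a ^ 2) - 1}

/-- The left-invariant vector field `∂_i`, the derivation of `R` with
`∂_i x_a = −F(a,i) x_{a+i}`. -/
noncomputable def pder (i : G3) : Derivation ℝ R8 R8 :=
  MvPolynomial.mkDerivation ℝ fun a => - C (octF a i) * X (a + i)

/-- The quadratic form `∑_a x_a²` whose value is `1` on the 7-sphere. -/
noncomputable def sphereNorm : R8 := ∑ a : G3, X a ^ 2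

/-- The integer-valued version of the octonion cochain `octF`. -/
def octFInt (a b : G3) : ℤ :=
  (-1) ^ ((a 0).val * (b 0).val + (a 0).val * (b 1).val + (a 0).val * (b 2).val
    + (a 1).val * (b 1).val + (a 1).val * (b 2).val + (a 2).val * (b 2).val
    + (a 0).val * (a 1).val * (b 2).val + (a 0).val * (b 1).val * (a 2).val
    + (b 0).val * (a 1).val * (a 2).val)

/-- The integer-valued version of the octonion associator `octPhi`. -/
def octPhiInt (a b c : G3) : ℤ :=
  (-1) ^ (a 0 * (b 1 * c 2 + b 2 * c 1) + a 1 * (b 2 * c 0 + b 0 * c 2)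
    + a 2 * (b 0 * c 1 + b 1 * c 0)).val

theorem octF_eq_intCast (a b : G3) : octF a b = (octFInt a b : ℝ) := by
  simp [octF, octFInt]

theorem octPhi_eq_intCast (a b c : G3) : octPhi a b c = (octPhiInt a b c : ℝ) := by
  simp [octPhi, octPhiInt]

theorem octF_mul_self (a b : G3) : octF a b * octF a b = 1 := by
  have h : ∀ a b : G3, octFInt a b * octFInt a b = 1 := by decide +kernel
  simp only [octF_eq_intCast]
  exact_mod_cast h a b

theorem octF_zero_right (a : G3) : octF a 0 = 1 := by
  simp [octF]

theorem octF_mul_octF_add_self (a b : G3) (hb : b ≠ 0) :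
    octF a b * octF (a + b) b = -1 := by
  have h : ∀ a b : G3, b ≠ 0 → octFInt a b * octFInt (a + b) b = -1 := by decide +kernel
  simp only [octF_eq_intCast]
  exact_mod_cast h a b hb

/-- The associator is the coboundary of the cochain. -/
theorem octPhi_mul_octF_mul_octF (a b c : G3) :
    octPhi a b c * (octF b c * octF a (b + c)) = octF a b * octF (a + b) c := by
  have h : ∀ a b c : G3, octPhiInt a b c * (octFInt b c * octFInt a (b + c))
      = octFInt a b * octFInt (a + b) c := by decide +kernel
  simp only [octF_eq_intCast, octPhi_eq_intCast]
  exact_mod_cast h a b c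

theorem octF_row_orthogonal (m n b : G3) (hmn : m ≠ n) :
    octF (b + n) m * octF (b + m) n = -(octF (b + m) m * octF (b + n) n) := by
  have h : ∀ m n b : G3, m ≠ n → octFInt (b + n) m * octFInt (b + m) n
      = -(octFInt (b + m) m * octFInt (b + n) n) := by decide +kernel
  simp only [octF_eq_intCast]
  exact_mod_cast h m n b hmn

theorem octF_column_orthogonal (b c m : G3) (hbc : b ≠ c) :
    octF (c + m) (m + (b + c)) * octF (b + m) (m + (b + c))
      = -(octF (b + m) m * octF (c + m) m) := by
  have h : ∀ b c m : G3, b ≠ c → octFInt (c + m) (m + (b + c)) * octFInt (b + m) (m + (b + c))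
      = -(octFInt (b + m) m * octFInt (c + m) m) := by decide +kernel
  simp only [octF_eq_intCast]
  exact_mod_cast h b c m hbc

theorem G3.add_self (a : G3) : a + a = 0 := CharTwo.add_self_eq_zero a

theorem G3.add_add_cancel_right (a b : G3) : a + b + b = a := by
  rw [add_assoc, G3.add_self, add_zero]

/-- A sum over `G` vanishes if translation by some `t` negates the summand. -/
theorem sum_eq_zero_of_translate_eq_neg (f : G3 → R8) (t : G3) (h : ∀ a, f (a + t) = -f a) :
    ∑ a, f a = 0 := by
  have h1 : ∑ a, f (a + t) = ∑ a, f a := Equiv.sum_comp (Equiv.addRight t) f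
  simp only [h, Finset.sum_neg_distrib] at h1
  exact self_eq_neg.mp h1.symm

/-- The matrix whose row `m` is the octonion product `x e_m`, for `x = ∑_a x_a e_a`. -/
noncomputable def octLeft : Matrix G3 G3 R8 :=
  Matrix.of fun m b => C (octF (b + m) m) * X (b + m)

/-- The matrix of right multiplication by the octonion unit `e_i`. -/
noncomputable def octRight (i : G3) : Matrix G3 G3 R8 :=
  Matrix.of fun b c => if c = b + i then C (octF b i) else 0

theorem sum_X_add_sq (t : G3) : ∑ a : G3, (X (a + t) : R8) ^ 2 = sphereNorm :=
  Equiv.sum_comp (Equiv.addRight t) fun a => (X a : R8) ^ 2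

theorem octLeft_mul_transpose : octLeft * octLeft.transpose = sphereNorm • 1 := by
  ext1 m n
  rw [Matrix.mul_apply, Matrix.smul_apply, Matrix.one_apply]
  simp only [octLeft, Matrix.transpose_apply, Matrix.of_apply]
  split_ifs with h
  · subst h
    rw [smul_eq_mul, mul_one, ← sum_X_add_sq m]
    refine Finset.sum_congr rfl fun b _ => ?_
    rw [mul_mul_mul_comm, ← C_mul, octF_mul_self, C_1, one_mul, sq]
  · rw [smul_zero]
    refine sum_eq_zero_of_translate_eq_neg _ (m + n) fun b => ?_
    have h1 : b + (m + n) + m = b + n := by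
      rw [add_comm m n, ← add_assoc, G3.add_add_cancel_right]
    have h2 : b + (m + n) + n = b + m := by
      rw [← add_assoc, G3.add_add_cancel_right]
    have h3 := congrArg (C (σ := G3)) (octF_row_orthogonal m n b h)
    simp only [C_mul, C_neg] at h3
    rw [h1, h2]
    linear_combination (X (b + n) * X (b + m)) * h3

theorem octLeft_transpose_mul : octLeft.transpose * octLeft = sphereNorm • 1 := by
  ext1 b c
  rw [Matrix.mul_apply, Matrix.smul_apply, Matrix.one_apply]
  simp only [octLeft, Matrix.transpose_apply, Matrix.of_apply]
  split_ifs with h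
  · subst h
    rw [smul_eq_mul, mul_one, ← sum_X_add_sq b]
    refine Finset.sum_congr rfl fun m _ => ?_
    rw [mul_mul_mul_comm, ← C_mul, octF_mul_self, C_1, one_mul, sq, add_comm]
  · rw [smul_zero]
    refine sum_eq_zero_of_translate_eq_neg _ (b + c) fun m => ?_
    have h1 : b + (m + (b + c)) = c + m := by
      rw [show b + (m + (b + c)) = c + m + b + b by abel, G3.add_add_cancel_right]
    have h2 : c + (m + (b + c)) = b + m := by
      rw [show c + (m + (b + c)) = b + m + c + c by abel, G3.add_add_cancel_right]
    have h3 := congrArg (C (σ := G3)) (octF_column_orthogonal b c m h)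
    simp only [C_mul, C_neg] at h3
    rw [h1, h2]
    linear_combination (X (c + m) * X (b + m)) * h3

theorem trace_octRight_mul (i j : G3) (hj : j ≠ 0) :
    (octRight i * octRight j).trace = if i = j then -8 else 0 := by
  have hdiag (b : G3) : (octRight i * octRight j) b b = if i = j then -1 else 0 := by
    simp only [Matrix.mul_apply, octRight, Matrix.of_apply, ite_mul, zero_mul,
      Finset.sum_ite_eq', Finset.mem_univ, if_true]
    have hb : b = b + i + j ↔ i = j := by
      rw [add_assoc, left_eq_add, CharTwo.add_eq_zero]
    simp only [hb]
    split_ifs with h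
    · subst h
      rw [← C_mul, octF_mul_octF_add_self b i hj, C_neg, C_1]
    · rw [mul_zero]
  simp only [Matrix.trace, Matrix.diag_apply, hdiag]
  split_ifs <;> simp

/-- The matrix of inner products `⟨(x e_m) e_i, x e_n⟩`. -/
noncomputable def octConj (i : G3) : Matrix G3 G3 R8 :=
  octLeft * octRight i * octLeft.transpose

theorem octLeft_mul_octRight_apply (i m c : G3) :
    (octLeft * octRight i) m c = octLeft m (c + i) * C (octF (c + i) i) := by
  rw [Matrix.mul_apply, Finset.sum_eq_single (c + i)]
  · simp [octRight, G3.add_add_cancel_right]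
  · intro b _ hb
    have : c ≠ b + i := by
      rintro rfl
      exact hb (G3.add_add_cancel_right b i).symm
    simp [octRight, this]
  · simp

theorem octConj_eq_cS (m i n : G3) (hn : n ≠ 0) : octConj i m n = cS m i n := by
  rw [octConj, Matrix.mul_apply, cS, Finset.mul_sum,
    ← Equiv.sum_comp (Equiv.addRight (m + i))]
  refine Finset.sum_congr rfl fun a _ => ?_
  have h1 : a + (m + i) + i = a + m := by rw [← add_assoc, G3.add_add_cancel_right]
  have h3 := octPhi_mul_octF_mul_octF a m i
  have h4 := octPhi_mul_octF_mul_octF a (m + i) n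
  have h5 := octF_mul_octF_add_self (a + (m + i)) n hn
  have h7 := octF_mul_self (a + (m + i)) n
  have key : octF a m * octF (a + m) i * octF (a + (m + i) + n) n
      = -(octF m i * octF (m + i) n) *
        (octPhi a m i * octPhi a (m + i) n * octF a (m + i + n)) := by
    have h8 : octF (a + (m + i) + n) n = -octF (a + (m + i)) n := by
      linear_combination octF (a + (m + i)) n * h5 - octF (a + (m + i) + n) n * h7
    rw [h8, ← h3]
    linear_combination (octPhi a m i * octF m i) * h4
  simp only [octLeft_mul_octRight_apply]
  simp only [octLeft, Matrix.transpose_apply, Matrix.of_apply,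
    Equiv.coe_addRight, h1, G3.add_add_cancel_right]
  have hC := congrArg (C (σ := G3)) key
  simp only [C_mul] at hC ⊢
  rw [show a + m + i + n = a + (m + i) + n by abel]
  linear_combination (X a * X (a + (m + i) + n)) * hC

theorem octConj_zero_left (i n : G3) :
    octConj i 0 n = if i = n then sphereNorm else 0 := by
  have h := congrFun (congrFun octLeft_mul_transpose i) n
  rw [Matrix.smul_apply, Matrix.one_apply, Matrix.mul_apply] at h
  rw [octConj, Matrix.mul_apply]
  simp only [octLeft_mul_octRight_apply]
  simp only [smul_eq_mul, mul_ite, mul_one, mul_zero] at h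
  rw [← h]
  refine Finset.sum_congr rfl fun c _ => ?_
  simp only [octLeft, Matrix.of_apply, add_zero, octF_zero_right, C_1]
  ring

theorem octConj_zero_right (j n : G3) (hj : j ≠ 0) :
    octConj j n 0 = if n = j then -sphereNorm else 0 := by
  have h := congrFun (congrFun octLeft_mul_transpose n) j
  rw [Matrix.smul_apply, Matrix.one_apply, Matrix.mul_apply] at h
  simp only [smul_eq_mul, mul_ite, mul_one, mul_zero] at h
  rw [show (if n = j then -sphereNorm else 0) = -(if n = j then sphereNorm else 0) by
    split_ifs <;> simp, ← h, octConj, Matrix.mul_apply,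
    ← Equiv.sum_comp (Equiv.addRight j), ← Finset.sum_neg_distrib]
  refine Finset.sum_congr rfl fun c _ => ?_
  simp only [octLeft_mul_octRight_apply]
  simp only [octLeft, Matrix.transpose_apply, Matrix.of_apply,
    Equiv.coe_addRight, G3.add_add_cancel_right, add_zero, octF_zero_right, C_1]
  have h1 := congrArg (C (σ := G3)) (octF_mul_octF_add_self c j hj)
  have h2 := congrArg (C (σ := G3)) (octF_mul_self (c + j) j)
  simp only [C_mul, C_neg, C_1] at h1 h2
  linear_combination (C (octF (c + n) n) * X (c + n) * X (c + j)) *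
    (C (octF (c + j) j) * h1 - C (octF c j) * h2)

theorem trace_octConj_mul (i j : G3) (hj : j ≠ 0) :
    (octConj i * octConj j).trace = if i = j then -8 * sphereNorm ^ 2 else 0 := by
  have h : octConj i * octConj j
      = octLeft * (octRight i * (octLeft.transpose * octLeft) * octRight j
        * octLeft.transpose) := by
    simp only [octConj, Matrix.mul_assoc]
  rw [h, Matrix.trace_mul_comm, Matrix.mul_assoc, octLeft_transpose_mul]
  simp only [Matrix.mul_smul, Matrix.smul_mul, Matrix.mul_one, Matrix.trace_smul,
    trace_octRight_mul i j hj, smul_eq_mul]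
  split_ifs <;> ring

/-- The Killing form identity in `R`, before passing to the quotient by the sphere relation. -/
theorem sum_cS_mul_cS (i j : G3) (hi : i ≠ 0) (hj : j ≠ 0) :
    ∑ m ∈ Finset.univ.erase (0 : G3), ∑ n ∈ Finset.univ.erase (0 : G3),
        cS m i n * cS n j m = if i = j then -6 * sphereNorm ^ 2 else 0 := by
  have hcS : ∑ m ∈ Finset.univ.erase (0 : G3), ∑ n ∈ Finset.univ.erase (0 : G3),
        cS m i n * cS n j m
      = ∑ m ∈ Finset.univ.erase (0 : G3), ∑ n ∈ Finset.univ.erase (0 : G3),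
        octConj i m n * octConj j n m :=
    Finset.sum_congr rfl fun m hm => Finset.sum_congr rfl fun n hn => by
      rw [octConj_eq_cS m i n (Finset.ne_of_mem_erase hn),
        octConj_eq_cS n j m (Finset.ne_of_mem_erase hm)]
  have htr := trace_octConj_mul i j hj
  simp only [Matrix.trace, Matrix.diag_apply, Matrix.mul_apply] at htr
  have hrow : ∑ n, octConj i 0 n * octConj j n 0 = if i = j then -sphereNorm ^ 2 else 0 := by
    simp only [octConj_zero_left, octConj_zero_right j _ hj, ite_mul, zero_mul,
      Finset.sum_ite_eq, Finset.mem_univ, if_true]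
    split_ifs <;> ring
  have hcol : ∑ m ∈ Finset.univ.erase (0 : G3), octConj i m 0 * octConj j 0 m
      = if i = j then -sphereNorm ^ 2 else 0 := by
    simp only [octConj_zero_left, octConj_zero_right i _ hi, ite_mul, zero_mul,
      Finset.sum_ite_eq', Finset.mem_erase, Finset.mem_univ, and_true]
    rw [if_pos hi]
    simp only [eq_comm (a := j)]
    split_ifs <;> ring
  rw [← Finset.add_sum_erase _ _ (Finset.mem_univ (0 : G3)), hrow,
    Finset.sum_congr rfl fun m _ =>
      (Finset.add_sum_erase _ (fun n => octConj i m n * octConj j n m)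
        (Finset.mem_univ (0 : G3))).symm,
    Finset.sum_add_distrib, hcol] at htr
  rw [hcS]
  split_ifs at htr ⊢ <;> linear_combination htr

/-- the Killing form of the 7-sphere structure functions is `−6δ_{ij}`:
for all nonzero `i, j ∈ G`, `∑_{m,n ≠ 0} c_{min} c_{njm} ≡ −6δ_{ij} (mod I)`. -/
theorem s7_killing_form (i j : G3) (hi : i ≠ 0) (hj : j ≠ 0) :
    (∑ m ∈ Finset.univ.erase (0 : G3), ∑ n ∈ Finset.univ.erase (0 : G3),
        cS m i n * cS n j m)
      - (if i = j then (-6 : R8) else 0) ∈ sphere7 := by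
  rw [sum_cS_mul_cS i j hi hj]
  split_ifs
  · refine Ideal.mem_span_singleton.mpr ⟨-6 * (sphereNorm + 1), ?_⟩
    rw [sphereNorm]
    ring
  · rw [sub_zero]
    exact zero_mem _
end

section
/- The divergence of the 7-sphere structure functions vanishes on S⁷: for all nonzero n, k ∈ G = (ℤ/2)³, Σ_{i ∈ G∖{0}} ∂_i c_{ink} ≡ 0 modulo the 7-sphere ideal I. (This is the term ∂_i cⁱ_{nk} in the Ricci computation, which must vanish for the Ricci tensor to be symmetric.) -/
open MvPolynomial

/-- The coefficient of `x_a x_{a+i+j+k}` in `c_{ijk}`, up to the factor independent of `a`. -/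
def structCoeffInt (i j k a : G3) : ℤ :=
  octPhiInt a i j * octPhiInt a (i + j) k * octFInt a (i + j + k)

/-- The coefficient of `x_a x_{a+j+k}` in `∂_i c_{ijk}`, up to the factor independent of `a`. -/
def divCoeffInt (i j k a : G3) : ℤ :=
  structCoeffInt i j k a * octFInt (a + i + j + k) i
    + structCoeffInt i j k (a + i) * octFInt (a + i) i

theorem divCoeffInt_add_divCoeffInt :
    ∀ i j k a : G3, i ≠ 0 → divCoeffInt i j k a + divCoeffInt i j k (a + (j + k)) = 0 := by
  decide +kernel

theorem pder_X (i a : G3) : pder i (X a) = -C (octF a i) * X (a + i) := by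
  simp [pder]

/-- A quadratic form `∑ d_a x_a x_{a+t}` vanishes if `d_a + d_{a+t} = 0` for all `a`. -/
theorem sum_mul_X_mul_X_eq_zero (t : G3) (d : G3 → R8) (hd : ∀ a, d a + d (a + t) = 0) :
    ∑ a, d a * (X a * X (a + t)) = 0 := by
  have h : ∑ a, d a * (X a * X (a + t)) = ∑ a, d (a + t) * (X a * X (a + t)) := by
    rw [← Equiv.sum_comp (Equiv.addRight t)]
    refine Finset.sum_congr rfl fun a _ => ?_
    simp only [Equiv.coe_addRight, add_assoc, G3.add_self, add_zero]
    ring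
  rw [← add_self_eq_zero]
  nth_rewrite 2 [h]
  rw [← Finset.sum_add_distrib]
  exact Finset.sum_eq_zero fun a _ => by rw [← add_mul, hd, zero_mul]

/-- Each vector field `∂_i` with `i ≠ 0` annihilates the structure functions `c_{ijk}`. -/
theorem pder_cS_self (i j k : G3) (hi : i ≠ 0) : pder i (cS i j k) = 0 := by
  have h_shift : ∑ a, (structCoeffInt i j k a * octFInt a i : R8)
        * (X (a + i + j + k) * X (a + i))
      = ∑ a, (structCoeffInt i j k (a + i) * octFInt (a + i) i : R8)
        * (X a * X (a + (j + k))) := by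
    rw [← Equiv.sum_comp (Equiv.addRight i)]
    refine Finset.sum_congr rfl fun a _ => ?_
    simp only [Equiv.coe_addRight, add_assoc, G3.add_self, add_zero]
    ring
  have h_zero := sum_mul_X_mul_X_eq_zero (j + k) (fun a => (divCoeffInt i j k a : R8)) fun a => by
    exact_mod_cast congrArg (Int.cast : ℤ → R8) (divCoeffInt_add_divCoeffInt i j k a hi)
  have h_sum : pder i (∑ a : G3, C (octPhi a i j * octPhi a (i + j) k * octF a (i + j + k)) *
      (X a * X (a + i + j + k))) = -∑ a, (divCoeffInt i j k a : R8) * (X a * X (a + (j + k))) := by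
    simp only [divCoeffInt, Int.cast_add, Int.cast_mul, add_mul, Finset.sum_add_distrib]
    rw [← h_shift, ← Finset.sum_add_distrib, ← Finset.sum_neg_distrib, map_sum]
    refine Finset.sum_congr rfl fun a _ => ?_
    have h_index : a + i + j + k + i = a + (j + k) := by
      rw [show a + i + j + k + i = a + (j + k) + (i + i) by abel, G3.add_self, add_zero]
    rw [C_mul', Derivation.map_smul, Derivation.leibniz, pder_X, pder_X, h_index, ← C_mul']
    simp only [octF_eq_intCast, octPhi_eq_intCast, structCoeffInt, smul_eq_mul, C_mul,
      Int.cast_mul, map_intCast]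
    ring
  rw [cS, C_mul', Derivation.map_smul, h_sum, h_zero, neg_zero, smul_zero]

/-- the divergence of the 7-sphere structure functions vanishes on `S⁷`:
for all nonzero `n, k ∈ G`, `∑_{i ≠ 0} ∂_i c_{ink} ≡ 0 (mod I)`. -/
theorem s7_divergence_vanishes (n k : G3) (hn : n ≠ 0) (hk : k ≠ 0) :
    (∑ i ∈ Finset.univ.erase (0 : G3), pder i (cS i n k)) ∈ sphere7 := by
  rw [Finset.sum_eq_zero fun i hi => pder_cS_self i n k (Finset.ne_of_mem_erase hi)]
  exact sphere7.zero_mem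
end

section
/- The left-invariant vector fields of the octonionic 7-sphere are tangent to the sphere: for every a ∈ G = (ℤ/2)³ and every nonzero i ∈ G, F(a+i, i) = −F(a, i). Consequently the derivation ∂_i annihilates the 7-sphere relation: ∂_i(Σ_{a∈G} x_a² − 1) = 0, so each ∂_i descends to the quotient ring R/I. -/
open MvPolynomial

theorem neg_one_pow_eq_neg_of_odd_add {R : Type*} [Monoid R] [HasDistribNeg R] {m n : ℕ}
    (h : Odd (m + n)) : (-1 : R) ^ m = -(-1) ^ n := by
  rcases Nat.even_or_odd n with hn | hn
  · rw [hn.neg_one_pow, (Nat.odd_add.mp h |>.mpr hn).neg_one_pow]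
  · rw [hn.neg_one_pow, (Nat.odd_add'.mp h |>.mp hn).neg_one_pow, neg_neg]

theorem octF_add_self_right {i : G3} (hi : i ≠ 0) (a : G3) :
    octF (a + i) i = -octF a i := by
  have key : ∀ a₀ a₁ a₂ i₀ i₁ i₂ : ZMod 2, ¬(i₀ = 0 ∧ i₁ = 0 ∧ i₂ = 0) →
      Odd ((a₀ + i₀).val * i₀.val + (a₀ + i₀).val * i₁.val + (a₀ + i₀).val * i₂.val
        + (a₁ + i₁).val * i₁.val + (a₁ + i₁).val * i₂.val + (a₂ + i₂).val * i₂.val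
        + (a₀ + i₀).val * (a₁ + i₁).val * i₂.val + (a₀ + i₀).val * i₁.val * (a₂ + i₂).val
        + i₀.val * (a₁ + i₁).val * (a₂ + i₂).val
        + (a₀.val * i₀.val + a₀.val * i₁.val + a₀.val * i₂.val
        + a₁.val * i₁.val + a₁.val * i₂.val + a₂.val * i₂.val
        + a₀.val * a₁.val * i₂.val + a₀.val * i₁.val * a₂.val
        + i₀.val * a₁.val * a₂.val)) := by
    decide
  have hi' : ¬(i 0 = 0 ∧ i 1 = 0 ∧ i 2 = 0) := fun h =>
    hi <| funext <| by simpa [Fin.forall_fin_succ] using h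
  have hodd := key (a 0) (a 1) (a 2) (i 0) (i 1) (i 2) hi'
  exact neg_one_pow_eq_neg_of_odd_add hodd

theorem pder_sum_sq {i : G3} (hi : i ≠ 0) : pder i (∑ a : G3, X a ^ 2) = 0 := by
  have hii : i + i = 0 := CharTwo.add_self_eq_zero i
  rw [map_sum]
  refine Finset.sum_involution (fun a _ => a + i) (fun a _ => ?_) (fun a _ _ => ?_)
    (fun a _ => Finset.mem_univ _) (fun a _ => by rw [add_assoc, hii, add_zero])
  · simp only [pder, Derivation.leibniz_pow, mkDerivation_X, octF_add_self_right hi, add_assoc,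
      hii, add_zero, C_neg, smul_eq_mul, nsmul_eq_mul]
    ring
  · simpa using hi

theorem Derivation.mem_span_singleton_of_apply_eq_zero {R A : Type*} [CommSemiring R]
    [CommSemiring A] [Algebra R A] (D : Derivation R A A) {f : A} (hf : D f = 0) {p : A}
    (hp : p ∈ Ideal.span {f}) : D p ∈ Ideal.span {f} := by
  obtain ⟨q, rfl⟩ := Ideal.mem_span_singleton'.mp hp
  rw [D.leibniz, hf, smul_zero, zero_add, smul_eq_mul]
  exact Ideal.mul_mem_right _ _ (Ideal.mem_span_singleton_self f)

/-- for every `a ∈ G` and nonzero `i ∈ G`, `F(a+i,i) = −F(a,i)`;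
consequently each `∂_i` annihilates the 7-sphere relation `∑_a x_a² − 1`, and hence
descends to the quotient ring `R/I` (it maps the ideal `I` into itself). -/
theorem s7_vector_fields_tangent (i : G3) (hi : i ≠ 0) :
    (∀ a : G3, octF (a + i) i = - octF a i) ∧
    pder i ((∑ a : G3, X a ^ 2) - 1) = 0 ∧
    ∀ p ∈ sphere7, pder i p ∈ sphere7 := by
  have h : pder i ((∑ a : G3, X a ^ 2) - 1) = 0 := by
    rw [map_sub, pder_sum_sq hi, Derivation.map_one_eq_zero, sub_zero]
  exact ⟨octF_add_self_right hi, h, fun _ =>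
    (pder i).mem_span_singleton_of_apply_eq_zero h⟩
end
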